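/- Let f : ℂ → ℂ be an entire function. Then f is a polynomial if and only if, for every integer m ≥ 1, the complex vector space { g : ℂ → ℂ entire : ∫_ℂ |g(z)|² (1 + |f′(z)|²)^{−(m−1)} dA(z) < ∞ } is finite-dimensional over ℂ, where dA is Lebesgue measure on ℂ ≅ ℝ². -/

import Mathlib

open MeasureTheory Filter Topology Metric

/-- An entire function whose high-order Taylor coefficients at `0` vanish is a polynomial. -/
theorem exists_polynomial_of_iteratedDeriv_eq_zero {g : ℂ → ℂ} (hg : Differentiable ℂ g) {n : ℕ}
    (h : ∀ k, n < k → iteratedDeriv k g 0 = 0) :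
    ∃ p ∈ Polynomial.degreeLT ℂ (n + 1), ∀ z, g z = p.eval z := by
  refine ⟨∑ k ∈ Finset.range (n + 1),
    Polynomial.C ((k.factorial : ℂ)⁻¹ * iteratedDeriv k g 0) * Polynomial.X ^ k, ?_, fun z => ?_⟩
  · refine Submodule.sum_mem _ fun k hk => ?_
    rw [Polynomial.mem_degreeLT]
    refine (Polynomial.degree_C_mul_X_pow_le _ _).trans_lt ?_
    exact_mod_cast Finset.mem_range.1 hk
  · rw [← Complex.taylorSeries_eq_of_entire' 0 z hg, tsum_eq_sum (s := Finset.range (n + 1))]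
    · simp [Polynomial.eval_finsetSum]
    · intro k hk
      rw [h k (by simpa using hk)]
      simp

theorem iteratedDeriv_eq_zero_of_norm_le_pow {g : ℂ → ℂ} (hg : Differentiable ℂ g) {n : ℕ}
    {C R : ℝ} (h : ∀ z, R ≤ ‖z‖ → ‖g z‖ ≤ C * ‖z‖ ^ n) {k : ℕ} (hk : n < k) :
    iteratedDeriv k g 0 = 0 := by
  have hlim : Tendsto (fun r : ℝ => k.factorial * C * r⁻¹) atTop (𝓝 (k.factorial * C * 0)) :=
    tendsto_inv_atTop_zero.const_mul _
  rw [mul_zero] at hlim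
  refine norm_le_zero_iff.1 (ge_of_tendsto hlim ?_)
  filter_upwards [eventually_ge_atTop R, eventually_ge_atTop 1] with r hR h1
  have h0 : 0 < r := by linarith
  have hb : ∀ z ∈ sphere (0 : ℂ) r, ‖g z‖ ≤ C * r ^ n := fun z hz => by
    rw [mem_sphere_zero_iff_norm] at hz
    simpa [hz] using h z (by rw [hz]; exact hR)
  have hC : 0 ≤ C := by
    have := (norm_nonneg _).trans (hb r (by simp [abs_of_pos h0]))
    exact nonneg_of_mul_nonneg_left this (by positivity)
  calc ‖iteratedDeriv k g 0‖ ≤ k.factorial * (C * r ^ n) / r ^ k :=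
        Complex.norm_iteratedDeriv_le_of_forall_mem_sphere_norm_le k h0 hg.diffContOnCl hb
    _ ≤ k.factorial * (C * r ^ n) / r ^ (n + 1) := by
        gcongr
        exact hk
    _ = k.factorial * C * r⁻¹ := by
        rw [pow_succ]
        field_simp

/-- **Casorati–Weierstrass at infinity**: an entire function that omits a neighbourhood of a value
near infinity has polynomial growth. -/
theorem exists_norm_le_pow_of_norm_sub_ge {h : ℂ → ℂ} (hh : Differentiable ℂ h) {b : ℂ} {ε R : ℝ}
    (hε : 0 < ε) (hb : ∀ z, R < ‖z‖ → ε ≤ ‖h z - b‖) :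
    ∃ (n : ℕ) (C R' : ℝ), ∀ z, R' ≤ ‖z‖ → ‖h z‖ ≤ C * ‖z‖ ^ n := by
  set F : ℂ → ℂ := fun w => (h w⁻¹ - b)⁻¹ with hF
  have hδ : 0 < (|R| + 1)⁻¹ := by positivity
  have hlarge : ∀ w ∈ ball (0 : ℂ) (|R| + 1)⁻¹ \ {0}, ε ≤ ‖h w⁻¹ - b‖ := by
    rintro w ⟨hw, hw0⟩
    apply hb
    rw [mem_ball_zero_iff] at hw
    rw [norm_inv]
    have := (lt_inv_comm₀ (norm_pos_iff.2 hw0) (by positivity)).1 hw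
    linarith [le_abs_self R]
  have hne : ∀ w ∈ ball (0 : ℂ) (|R| + 1)⁻¹ \ {0}, h w⁻¹ - b ≠ 0 := fun w hw =>
    norm_pos_iff.1 (hε.trans_le (hlarge w hw))
  have hd : DifferentiableOn ℂ F (ball 0 (|R| + 1)⁻¹ \ {0}) := by
    intro w hw
    have hw0 : w ≠ 0 := hw.2
    have hcomp : DifferentiableAt ℂ (fun w => h w⁻¹) w :=
      (hh w⁻¹).comp w (differentiableAt_id.inv hw0)
    exact ((hcomp.sub_const b).inv (hne w hw)).differentiableWithinAt
  have hbd : BddAbove (norm ∘ F '' (ball 0 (|R| + 1)⁻¹ \ {0})) := by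
    refine ⟨ε⁻¹, ?_⟩
    rintro _ ⟨w, hw, rfl⟩
    simp only [Function.comp, hF, norm_inv]
    exact inv_anti₀ hε (hlarge w hw)
  have hball : ball (0 : ℂ) (|R| + 1)⁻¹ ∈ 𝓝 0 := ball_mem_nhds _ hδ
  have hG := Complex.differentiableOn_update_limUnder_of_bddAbove hball hd hbd
  set G := Function.update F 0 (limUnder (𝓝[≠] 0) F) with hGdef
  have hGF : ∀ w, w ≠ 0 → G w = F w := fun w hw => Function.update_of_ne hw _ _
  have hGan : AnalyticAt ℂ G 0 := hG.analyticAt hball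
  have hpunct : ∀ᶠ w in 𝓝[≠] (0 : ℂ), w ∈ ball (0 : ℂ) (|R| + 1)⁻¹ \ {0} :=
    inter_mem (mem_nhdsWithin_of_mem_nhds hball) self_mem_nhdsWithin
  have hnz : ¬ ∀ᶠ w in 𝓝 (0 : ℂ), G w = 0 := by
    intro h0
    obtain ⟨w, hw, hw'⟩ := ((h0.filter_mono nhdsWithin_le_nhds).and hpunct).exists
    rw [hGF w hw'.2] at hw
    exact inv_ne_zero (hne w hw') hw
  obtain ⟨n, u, hu, hu0, hGu⟩ := hGan.exists_eventuallyEq_pow_smul_nonzero_iff.2 hnz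
  set c := ‖u 0‖ / 2 with hc
  have hc0 : 0 < c := by have := norm_pos_iff.2 hu0; positivity
  have huc : ∀ᶠ w in 𝓝 (0 : ℂ), c < ‖u w‖ :=
    hu.continuousAt.norm.eventually (lt_mem_nhds (by have := norm_pos_iff.2 hu0; linarith))
  obtain ⟨δ, hδ0, hδ'⟩ := Metric.eventually_nhds_iff.1 (hGu.and huc)
  refine ⟨n, c⁻¹ + ‖b‖, max (max (|R| + 2) (2 * δ⁻¹)) 1, fun z hz => ?_⟩
  have hz1 : 1 ≤ ‖z‖ := (le_max_right _ _).trans hz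
  have hzR : |R| + 2 ≤ ‖z‖ := ((le_max_left _ _).trans (le_max_left _ _)).trans hz
  have hzδ : 2 * δ⁻¹ ≤ ‖z‖ := ((le_max_right _ _).trans (le_max_left _ _)).trans hz
  have hzpos : 0 < ‖z‖ := by linarith
  have hz0 : z ≠ 0 := norm_pos_iff.1 hzpos
  have hδi : 0 < δ⁻¹ := by positivity
  have hzin : dist z⁻¹ 0 < δ := by
    rw [dist_zero_right, norm_inv, inv_lt_comm₀ hzpos hδ0]
    linarith
  obtain ⟨h1, h2⟩ := hδ' hzin
  rw [hGF _ (inv_ne_zero hz0), sub_zero, smul_eq_mul] at h1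
  simp only [hF, inv_inv] at h1
  have h3 : ‖h z - b‖ = ‖u z⁻¹‖⁻¹ * ‖z‖ ^ n := by
    rw [← inv_inv (h z - b), h1]
    simp [mul_comm]
  calc ‖h z‖ = ‖(h z - b) + b‖ := by simp
    _ ≤ ‖h z - b‖ + ‖b‖ := norm_add_le _ _
    _ ≤ c⁻¹ * ‖z‖ ^ n + ‖b‖ * ‖z‖ ^ n := by
      rw [h3]
      gcongr
      exact le_mul_of_one_le_right (norm_nonneg _) (one_le_pow₀ hz1)
    _ = _ := by ring

/-- An entire function either has polynomial growth or takes some value infinitely often. -/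
theorem exists_infinite_fiber {h : ℂ → ℂ} (hh : Differentiable ℂ h)
    (hgrowth : ¬ ∃ (n : ℕ) (C R : ℝ), ∀ z, R ≤ ‖z‖ → ‖h z‖ ≤ C * ‖z‖ ^ n) :
    ∃ a, {z | h z = a}.Infinite := by
  have hopen : IsOpenMap h := by
    rcases AnalyticOnNhd.is_constant_or_isOpenMap
      (Complex.analyticOnNhd_univ_iff_differentiable.2 hh) with ⟨w, hw⟩ | ho
    · exact (hgrowth ⟨0, ‖w‖, 0, fun z _ => by simp [hw z]⟩).elim
    · exact ho
  have hdense : Dense (⋂ n : ℕ, h '' {z | (n : ℝ) < ‖z‖}) := by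
    refine dense_iInter_of_isOpen
      (fun n => hopen _ (isOpen_lt continuous_const continuous_norm)) fun n => ?_
    by_contra hnd
    obtain ⟨b, hb⟩ := not_forall.1 hnd
    rw [Metric.mem_closure_iff] at hb
    push Not at hb
    obtain ⟨ε, hε, hb⟩ := hb
    refine hgrowth (exists_norm_le_pow_of_norm_sub_ge hh (b := b) (R := n) hε fun z hz => ?_)
    rw [← dist_eq_norm, dist_comm]
    exact hb _ ⟨z, hz, rfl⟩
  obtain ⟨a, ha⟩ := hdense.nonempty
  refine ⟨a, fun hfin => ?_⟩
  obtain ⟨C, hC⟩ := hfin.isBounded.exists_norm_le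
  obtain ⟨n, hn⟩ := exists_nat_ge C
  obtain ⟨z, hz, hza⟩ := Set.mem_iInter.1 ha n
  exact (hz.trans_le (hC z hza)).not_ge hn

/-- Dividing an entire function by finitely many of its zeros. -/
theorem exists_eq_prod_sub_mul {H : ℂ → ℂ} (hH : Differentiable ℂ H) (S : Finset ℂ)
    (hS : ∀ s ∈ S, H s = 0) :
    ∃ G : ℂ → ℂ, Differentiable ℂ G ∧ ∀ z, H z = (∏ s ∈ S, (z - s)) * G z := by
  induction S using Finset.induction_on with
  | empty => exact ⟨H, hH, by simp⟩
  | insert s T hs ih =>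
    obtain ⟨G, hG, hHG⟩ := ih fun t ht => hS t (Finset.mem_insert_of_mem ht)
    have hGs : G s = 0 := by
      have h0 := hS s (Finset.mem_insert_self s T)
      rw [hHG, mul_eq_zero, Finset.prod_eq_zero_iff] at h0
      refine h0.resolve_left ?_
      rintro ⟨t, ht, hst⟩
      exact hs (sub_eq_zero.1 hst ▸ ht)
    refine ⟨dslope G s, ?_, fun z => ?_⟩
    · rw [← differentiableOn_univ, Complex.differentiableOn_dslope univ_mem]
      exact hG.differentiableOn
    · rw [Finset.prod_insert hs, hHG]
      have := sub_smul_dslope G s z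
      rw [hGs, sub_zero, smul_eq_mul] at this
      rw [← this]
      ring

theorem Polynomial.exists_norm_eval_le (p : Polynomial ℂ) {n : ℕ} (hp : p.natDegree ≤ n) :
    ∃ C, 0 ≤ C ∧ ∀ z : ℂ, ‖p.eval z‖ ≤ C * (1 + ‖z‖) ^ n := by
  refine ⟨∑ i ∈ Finset.range (p.natDegree + 1), ‖p.coeff i‖,
    Finset.sum_nonneg fun _ _ => norm_nonneg _, fun z => ?_⟩
  rw [Polynomial.eval_eq_sum_range, Finset.sum_mul]
  refine norm_sum_le_of_le _ fun i hi => ?_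
  rw [norm_mul, norm_pow]
  have hi' : i ≤ n := by have := Finset.mem_range.1 hi; omega
  gcongr
  calc ‖z‖ ^ i ≤ (1 + ‖z‖) ^ i := by gcongr; linarith
    _ ≤ (1 + ‖z‖) ^ n := pow_le_pow_right₀ (by linarith [norm_nonneg z]) hi'

/-- The **mean value property** of an entire function over the unit disc. -/
theorem integral_ball_eq_pi_mul {F : ℂ → ℂ} (hF : Differentiable ℂ F) (z : ℂ) :
    ∫ w in ball z 1, F w = Real.pi * F z := by
  set v : ℝ × ℝ → ℂ := fun p => p.1 • F (z + Complex.polarCoord.symm p) with hv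
  have hvc : Continuous v := by
    have := hF.continuous
    simp only [hv, Complex.polarCoord_symm_apply]
    fun_prop
  have hint : IntegrableOn v (Set.Ioo 0 1 ×ˢ Set.Ioo (-Real.pi) Real.pi) (volume.prod volume) :=
    (hvc.continuousOn.integrableOn_compact (isCompact_Icc.prod isCompact_Icc)).mono_set
      (Set.prod_mono Set.Ioo_subset_Icc_self Set.Ioo_subset_Icc_self)
  have hinner (r : ℝ) : ∫ θ in Set.Ioo (-Real.pi) Real.pi, v (r, θ) =
      (r * (2 * Real.pi) : ℝ) • F z := by
    have hper : Function.Periodic (fun θ : ℝ => F (circleMap z r θ)) (2 * Real.pi) := fun θ => by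
      simp only [periodic_circleMap z r θ]
    have hmean : Real.circleAverage F z r = F z := hF.diffContOnCl.circleAverage
    rw [Real.circleAverage_def, inv_smul_eq_iff₀ (by positivity)] at hmean
    have h1 := hper.intervalIntegral_add_eq 0 (-Real.pi)
    rw [zero_add, hmean, show -Real.pi + 2 * Real.pi = Real.pi by ring] at h1
    rw [← integral_Ioc_eq_integral_Ioo, ← intervalIntegral.integral_of_le
      (by linarith [Real.pi_pos]), mul_smul, h1, ← intervalIntegral.integral_smul]
    refine intervalIntegral.integral_congr fun θ _ => ?_
    simp [hv, circleMap, Complex.exp_mul_I]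
  have hshift : ∫ w in ball z 1, F w = ∫ w, (ball (0 : ℂ) 1).indicator (fun w => F (z + w)) w := by
    rw [← integral_indicator measurableSet_ball, ← integral_add_left_eq_self _ z]
    refine integral_congr_ae (.of_forall fun w => ?_)
    simp [Set.indicator, dist_eq_norm]
  have hpolar : ∀ p ∈ polarCoord.target,
      p.1 • (ball (0 : ℂ) 1).indicator (fun w => F (z + w)) (Complex.polarCoord.symm p) =
        (Set.Iio (1 : ℝ) ×ˢ Set.univ).indicator v p := by
    rintro ⟨r, θ⟩ ⟨hr, -⟩
    have hr' : 0 < r := hr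
    have hmem : Complex.polarCoord.symm (r, θ) ∈ ball (0 : ℂ) 1 ↔ r < 1 := by
      rw [mem_ball_zero_iff, Complex.norm_polarCoord_symm, abs_of_pos hr']
    by_cases h : r < 1
    · rw [Set.indicator_of_mem (hmem.2 h), Set.indicator_of_mem (by simpa using h)]
    · rw [Set.indicator_of_notMem (hmem.not.2 h), Set.indicator_of_notMem (by simpa using h),
        smul_zero]
  rw [hshift, ← Complex.integral_comp_polarCoord_symm,
    setIntegral_congr_fun polarCoord.open_target.measurableSet hpolar,
    setIntegral_indicator (measurableSet_Iio.prod MeasurableSet.univ), polarCoord_target,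
    Set.prod_inter_prod, Set.Ioi_inter_Iio, Set.inter_univ, Measure.volume_eq_prod,
    setIntegral_prod _ hint]
  simp_rw [hinner]
  rw [integral_smul_const, ← integral_Ioc_eq_integral_Ioo,
    ← intervalIntegral.integral_of_le zero_le_one, intervalIntegral.integral_mul_const, integral_id,
    Complex.real_smul]
  congr 2
  ring

/-- An entire function that is square integrable against a weight decaying at most polynomially
has polynomial growth. -/
theorem norm_le_of_integrable_weight {g : ℂ → ℂ} (hg : Differentiable ℂ g) {W : ℂ → ℝ} {N : ℕ}
    {C : ℝ} (hW : ∀ z, 0 < W z) (hC : 0 ≤ C) (hWle : ∀ z, W z ≤ C * (1 + ‖z‖) ^ N)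
    (hint : Integrable fun z => ‖g z‖ ^ 2 / W z) (z : ℂ) :
    ‖g z‖ ^ 2 ≤ C * (2 + ‖z‖) ^ N * ∫ w, ‖g w‖ ^ 2 / W w := by
  have hmean := integral_ball_eq_pi_mul (hg.pow 2) z
  have hcont : Continuous fun w => ‖g w‖ ^ 2 := hg.continuous.norm.pow 2
  have hpi : 1 ≤ Real.pi := by linarith [Real.pi_gt_three]
  calc ‖g z‖ ^ 2 ≤ Real.pi * ‖g z‖ ^ 2 := le_mul_of_one_le_left (by positivity) hpi
    _ = ‖∫ w in ball z 1, (g ^ 2) w‖ := by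
      rw [hmean]; simp [abs_of_pos Real.pi_pos]
    _ ≤ ∫ w in ball z 1, ‖(g ^ 2) w‖ := norm_integral_le_integral_norm _
    _ = ∫ w in ball z 1, ‖g w‖ ^ 2 := by simp
    _ ≤ ∫ w in ball z 1, C * (2 + ‖z‖) ^ N * (‖g w‖ ^ 2 / W w) := by
      refine setIntegral_mono_on ?_ (hint.const_mul _).integrableOn measurableSet_ball
        fun w hw => ?_
      · exact (hcont.continuousOn.integrableOn_compact
          (isCompact_closedBall z 1)).mono_set ball_subset_closedBall
      · have hw1 : ‖w‖ ≤ 1 + ‖z‖ := by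
          have := norm_sub_norm_le w z
          have := mem_ball_iff_norm.1 hw
          linarith
        have hWw : W w ≤ C * (2 + ‖z‖) ^ N := by
          refine (hWle w).trans ?_
          gcongr C * ?_ ^ N
          linarith
        rw [mul_div_assoc', le_div_iff₀ (hW w), mul_comm]
        gcongr
    _ ≤ ∫ w, C * (2 + ‖z‖) ^ N * (‖g w‖ ^ 2 / W w) :=
      setIntegral_le_integral (hint.const_mul _) (.of_forall fun w => by
        have := hW w
        positivity)
    _ = _ := integral_const_mul _ _

/-- A continuous function on the plane that is `O(‖z‖⁻⁴)` at infinity is integrable. -/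
theorem integrable_of_norm_le_inv_pow {u : ℂ → ℝ} (hu : Continuous u) {C R : ℝ}
    (h : ∀ z, R ≤ ‖z‖ → ‖u z‖ ≤ C * (1 + ‖z‖) ^ (-4 : ℝ)) : Integrable u := by
  refine hu.locallyIntegrable.integrable_of_isBigO_cocompact
    (g := fun z : ℂ => (1 + ‖z‖) ^ (-4 : ℝ)) ?_ ?_
  · refine Asymptotics.IsBigO.of_bound C ?_
    filter_upwards [tendsto_norm_cocompact_atTop.eventually (eventually_ge_atTop R)] with z hz
    rw [Real.norm_of_nonneg (by positivity : 0 ≤ (1 + ‖z‖) ^ (-4 : ℝ))]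
    exact h z hz
  · refine (integrable_one_add_norm ?_).integrableAtFilter _
    rw [Complex.finrank_real_complex]
    norm_num

/-- If `h` takes the value `a` infinitely often, then for every `N` some nonzero entire `G` has
`p * G` square integrable against `(1 + ‖h‖ ^ 2)⁻¹` for all polynomials `p` of degree less than
`N`. -/
theorem exists_integrable_polynomial_mul {h : ℂ → ℂ} (hh : Differentiable ℂ h) {a : ℂ}
    (hne : ∃ z, h z ≠ a) (ha : {z | h z = a}.Infinite) (N : ℕ) :
    ∃ G : ℂ → ℂ, Differentiable ℂ G ∧ (∃ z, G z ≠ 0) ∧ ∀ p ∈ Polynomial.degreeLT ℂ N,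
      Integrable fun z => ‖p.eval z * G z‖ ^ 2 / (1 + ‖h z‖ ^ 2) := by
  obtain ⟨S, hS, hcard⟩ := ha.exists_subset_card_eq (N + 2)
  obtain ⟨G, hG, hHG⟩ := exists_eq_prod_sub_mul (hh.sub_const a) S
    fun s hs => sub_eq_zero.2 (hS hs)
  refine ⟨G, hG, ?_, fun p hp => ?_⟩
  · obtain ⟨z, hz⟩ := hne
    refine ⟨z, fun h0 => hz (sub_eq_zero.1 ?_)⟩
    rw [hHG, h0, mul_zero]
  have hdeg : p.natDegree ≤ N := by
    by_cases hp0 : p = 0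
    · simp [hp0]
    · exact ((Polynomial.natDegree_lt_iff_degree_lt hp0).2 (Polynomial.mem_degreeLT.1 hp)).le
  obtain ⟨C, hC, hpC⟩ := p.exists_norm_eval_le hdeg
  obtain ⟨r, hr⟩ := S.finite_toSet.isBounded.exists_norm_le
  have hcont : Continuous fun z => ‖p.eval z * G z‖ ^ 2 / (1 + ‖h z‖ ^ 2) := by
    have := hG.continuous
    have := hh.continuous
    refine Continuous.div (by fun_prop) (by fun_prop) fun z => by positivity
  refine integrable_of_norm_le_inv_pow hcont
    (C := (C * 4 ^ (N + 2)) ^ 2 * (2 * (1 + ‖a‖ ^ 2))) (R := 1 + 2 * |r|) fun z hz => ?_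
  set t := 1 + ‖z‖ with ht
  have htpos : 0 < t := by positivity
  have hprod : (t / 4) ^ (N + 2) ≤ ‖∏ s ∈ S, (z - s)‖ := by
    rw [norm_prod, ← hcard, ← Finset.prod_const]
    refine Finset.prod_le_prod (fun _ _ => by positivity) fun s hs => ?_
    have h1 := norm_sub_norm_le z s
    have h2 := hr s hs
    have h3 := le_abs_self r
    have h4 := abs_nonneg r
    linarith
  have hle : ‖p.eval z * G z‖ * t ^ 2 ≤ C * 4 ^ (N + 2) * ‖h z - a‖ := by
    rw [hHG, norm_mul, norm_mul]
    calc ‖p.eval z‖ * ‖G z‖ * t ^ 2 ≤ C * t ^ N * ‖G z‖ * t ^ 2 := by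
          gcongr
          exact hpC z
      _ = C * 4 ^ (N + 2) * ((t / 4) ^ (N + 2) * ‖G z‖) := by
          rw [div_pow, pow_add t]
          field_simp
      _ ≤ _ := by gcongr
  have hsub : ‖h z - a‖ ^ 2 ≤ 2 * (1 + ‖a‖ ^ 2) * (1 + ‖h z‖ ^ 2) := by
    have h1 : ‖h z - a‖ ^ 2 ≤ (‖h z‖ + ‖a‖) ^ 2 := by
      gcongr
      exact norm_sub_le _ _
    nlinarith [sq_nonneg (‖h z‖ - ‖a‖), mul_nonneg (sq_nonneg ‖h z‖) (sq_nonneg ‖a‖)]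
  rw [Real.norm_of_nonneg (by positivity), Real.rpow_neg htpos.le, ← div_eq_mul_inv,
    show (4 : ℝ) = (4 : ℕ) by norm_num, Real.rpow_natCast, div_le_div_iff₀ (by positivity)
    (by positivity)]
  calc ‖p.eval z * G z‖ ^ 2 * t ^ 4 = (‖p.eval z * G z‖ * t ^ 2) ^ 2 := by ring
    _ ≤ (C * 4 ^ (N + 2) * ‖h z - a‖) ^ 2 := by gcongr
    _ = (C * 4 ^ (N + 2)) ^ 2 * ‖h z - a‖ ^ 2 := by ring
    _ ≤ (C * 4 ^ (N + 2)) ^ 2 * (2 * (1 + ‖a‖ ^ 2) * (1 + ‖h z‖ ^ 2)) := by gcongr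
    _ = _ := by push_cast; ring

/-- The linear map sending a polynomial `p` to the function `z ↦ p(z) G(z)`. -/
noncomputable def polynomialMul (G : ℂ → ℂ) : Polynomial ℂ →ₗ[ℂ] ℂ → ℂ where
  toFun p z := p.eval z * G z
  map_add' p q := by ext z; simp [add_mul]
  map_smul' c p := by ext z; simp [mul_assoc]

theorem polynomialMul_injective {G : ℂ → ℂ} (hG : Continuous G) (h0 : ∃ z, G z ≠ 0) :
    Function.Injective (polynomialMul G) := by
  rw [injective_iff_map_eq_zero]
  intro p hp
  by_contra hp0
  obtain ⟨z₀, hz₀⟩ := h0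
  have hdense : Dense ({z | p.IsRoot z}ᶜ) :=
    Set.Countable.dense_compl ℝ (Polynomial.finite_setOfPred_isRoot hp0).countable
  have hG0 : G = 0 := hG.ext_on hdense continuous_const fun z hz =>
    (mul_eq_zero.1 (congrFun hp z)).resolve_left hz
  exact hz₀ (congrFun hG0 z₀)

theorem le_finrank_of_polynomialMul_mem {G : ℂ → ℂ} (hG : Continuous G) (h0 : ∃ z, G z ≠ 0)
    {E : Submodule ℂ (ℂ → ℂ)} [FiniteDimensional ℂ E] {N : ℕ}
    (h : ∀ p ∈ Polynomial.degreeLT ℂ N, polynomialMul G p ∈ E) : N ≤ Module.finrank ℂ E := by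
  have hle : (Polynomial.degreeLT ℂ N).map (polynomialMul G) ≤ E := by
    rintro _ ⟨p, hp, rfl⟩
    exact h p hp
  calc N = Module.finrank ℂ (Polynomial.degreeLT ℂ N) := by
        rw [(Polynomial.degreeLTEquiv ℂ N).finrank_eq, Module.finrank_fin_fun]
    _ = Module.finrank ℂ ((Polynomial.degreeLT ℂ N).map (polynomialMul G)) :=
        ((Polynomial.degreeLT ℂ N).equivMapOfInjective _
          (polynomialMul_injective hG h0)).finrank_eq
    _ ≤ _ := Submodule.finrank_mono hle

/-- The entire functions `g` with `‖g‖ ^ 2 / W` integrable. -/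
def weightedBergman (W : ℂ → ℝ) (hW : Continuous W) (hpos : ∀ z, 0 < W z) :
    Submodule ℂ (ℂ → ℂ) where
  carrier := {g | Differentiable ℂ g ∧ Integrable fun z => ‖g z‖ ^ 2 / W z}
  zero_mem' := ⟨differentiable_const 0, by simp⟩
  add_mem' := by
    rintro g₁ g₂ ⟨hg₁, hi₁⟩ ⟨hg₂, hi₂⟩
    refine ⟨hg₁.add hg₂, ((hi₁.add hi₂).const_mul 2).mono'
      (Continuous.aestronglyMeasurable ?_) (.of_forall fun z => ?_)⟩
    · exact ((hg₁.add hg₂).continuous.norm.pow 2).div hW fun z => (hpos z).ne'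
    · have hz := hpos z
      rw [Real.norm_of_nonneg (by positivity), Pi.add_apply, Pi.add_apply, ← add_div,
        mul_div_assoc']
      gcongr
      have h1 := norm_add_le (g₁ z) (g₂ z)
      have h2 : ‖g₁ z + g₂ z‖ ^ 2 ≤ (‖g₁ z‖ + ‖g₂ z‖) ^ 2 := by gcongr
      nlinarith [sq_nonneg (‖g₁ z‖ - ‖g₂ z‖)]
  smul_mem' := by
    rintro c g ⟨hg, hi⟩
    refine ⟨hg.const_smul c, (hi.const_mul (‖c‖ ^ 2)).congr (.of_forall fun z => ?_)⟩
    simp only [Pi.smul_apply, norm_smul, mul_pow, mul_div_assoc]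

theorem weightedBergman_finiteDimensional {W : ℂ → ℝ} (hW : Continuous W) (hpos : ∀ z, 0 < W z)
    {N : ℕ} {C : ℝ} (hC : 0 ≤ C) (hWle : ∀ z, W z ≤ C * (1 + ‖z‖) ^ N) :
    FiniteDimensional ℂ (weightedBergman W hW hpos) := by
  have hle : weightedBergman W hW hpos ≤
      (Polynomial.degreeLT ℂ (N + 1)).map (polynomialMul 1) := by
    rintro g ⟨hg, hi⟩
    have hgrowth : ∀ z, 2 ≤ ‖z‖ →
        ‖g z‖ ≤ (1 + C * 2 ^ N * ∫ w, ‖g w‖ ^ 2 / W w) * ‖z‖ ^ N := by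
      intro z hz
      have hI : 0 ≤ ∫ w, ‖g w‖ ^ 2 / W w := integral_nonneg fun w => by
        have := hpos w
        positivity
      have h1 : 1 ≤ ‖z‖ ^ N := one_le_pow₀ (by linarith)
      calc ‖g z‖ ≤ 1 + ‖g z‖ ^ 2 := by nlinarith [sq_nonneg (‖g z‖ - 1)]
        _ ≤ 1 + C * (2 + ‖z‖) ^ N * ∫ w, ‖g w‖ ^ 2 / W w := by
          gcongr
          exact norm_le_of_integrable_weight hg hpos hC hWle hi z
        _ ≤ ‖z‖ ^ N + C * (2 * ‖z‖) ^ N * ∫ w, ‖g w‖ ^ 2 / W w := by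
          gcongr
          linarith
        _ = _ := by rw [mul_pow]; ring
    obtain ⟨p, hp, hgp⟩ := exists_polynomial_of_iteratedDeriv_eq_zero hg
      fun k hk => iteratedDeriv_eq_zero_of_norm_le_pow hg hgrowth hk
    exact ⟨p, hp, funext fun z => by simp [polynomialMul, hgp z]⟩
  have : FiniteDimensional ℂ (Polynomial.degreeLT ℂ (N + 1)) :=
    (Polynomial.degreeLTEquiv ℂ (N + 1)).symm.finiteDimensional
  exact Submodule.finiteDimensional_of_le hle

/-- Theorem 1.12 of the paper, through the identification of `P_{m,L²}(Γ(f))` with the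
dimension of a weighted Bergman space of entire functions: an entire function `f : ℂ → ℂ` is
a polynomial if and only if, for every `m ≥ 1`, the set of entire functions `g` with
`∫_ℂ |g|² (1+|f′|²)^{−(m−1)} dA < ∞` is a (complex vector subspace and a)
finite-dimensional complex vector space. -/
theorem stmt_9 (f : ℂ → ℂ) (hf : Differentiable ℂ f) :
    (∃ p : Polynomial ℂ, ∀ z, f z = p.eval z) ↔
      (∀ m : ℕ, 1 ≤ m →
        ∃ E : Submodule ℂ (ℂ → ℂ),
          (E : Set (ℂ → ℂ)) = {g | Differentiable ℂ g ∧
            Integrable (fun z : ℂ => ‖g z‖ ^ 2 / (1 + ‖deriv f z‖ ^ 2) ^ (m - 1))} ∧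
          FiniteDimensional ℂ E) := by
  refine ⟨?_, fun H => ?_⟩
  · rintro ⟨p, hp⟩ m -
    have hderiv : ∀ z, deriv f z = p.derivative.eval z := fun z => by
      rw [funext hp, p.deriv]
    obtain ⟨C, hC, hpC⟩ := p.derivative.exists_norm_eval_le le_rfl
    have hcont : Continuous fun z => (1 + ‖deriv f z‖ ^ 2) ^ (m - 1) := by
      simp only [hderiv]
      fun_prop
    refine ⟨weightedBergman _ hcont fun z => by positivity, rfl,
      weightedBergman_finiteDimensional hcont _ (N := 2 * p.derivative.natDegree * (m - 1))
        (C := (1 + C ^ 2) ^ (m - 1)) (by positivity) fun z => ?_⟩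
    rw [pow_mul, ← mul_pow, hderiv]
    gcongr
    have h1 : 1 ≤ (1 + ‖z‖) ^ (2 * p.derivative.natDegree) :=
      one_le_pow₀ (by linarith [norm_nonneg z])
    have h2 : ‖p.derivative.eval z‖ ^ 2 ≤ C ^ 2 * (1 + ‖z‖) ^ (2 * p.derivative.natDegree) :=
      calc ‖p.derivative.eval z‖ ^ 2 ≤ (C * (1 + ‖z‖) ^ p.derivative.natDegree) ^ 2 := by
            gcongr
            exact hpC z
        _ = _ := by ring
    linarith
  · have hd : Differentiable ℂ (deriv f) := hf.deriv
    by_cases hgrowth : ∃ (n : ℕ) (C R : ℝ), ∀ z, R ≤ ‖z‖ → ‖deriv f z‖ ≤ C * ‖z‖ ^ n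
    · obtain ⟨n, C, R, hle⟩ := hgrowth
      obtain ⟨p, -, hp⟩ := exists_polynomial_of_iteratedDeriv_eq_zero hf (n := n + 1) fun k hk => by
        obtain ⟨k, rfl⟩ := Nat.exists_eq_add_of_lt hk
        rw [iteratedDeriv_succ']
        exact iteratedDeriv_eq_zero_of_norm_le_pow hd hle (by omega)
      exact ⟨p, hp⟩
    · exfalso
      obtain ⟨a, ha⟩ := exists_infinite_fiber hd hgrowth
      have hne : ∃ z, deriv f z ≠ a := by
        by_contra! hconst
        exact hgrowth ⟨0, ‖a‖, 0, fun z _ => by simp [hconst z]⟩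
      obtain ⟨E, hE, hfin⟩ := H 2 one_le_two
      obtain ⟨G, hG, hG0, hint⟩ :=
        exists_integrable_polynomial_mul hd hne ha (Module.finrank ℂ E + 1)
      refine (Nat.lt_succ_self _).not_ge
        (le_finrank_of_polynomialMul_mem hG.continuous hG0 (E := E) fun p hp => ?_)
      rw [← SetLike.mem_coe, hE]
      exact ⟨p.differentiable.mul hG, by simpa [polynomialMul] using hint p hp⟩
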